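/- For 0 < L < M and α ≥ 1, for any y ∈ [L,M] one has max(u(L,y), u(M,y)) ≥ ((M-L)/(M+L))^α, with equality iff y = 2LM/(L+M). That is, the jammer's minimax over pure strategies against the receiver's best pure response equals the equilibrium value, attained uniquely at j*. -/

import Mathlib

theorem stmt_19 (L M α : ℝ) (hL : 0 < L) (hLM : L < M) (hα : 1 ≤ α) :
    ∀ y ∈ Set.Icc L M,
      ((M - L) / (M + L)) ^ α ≤ max (((y - L) / L) ^ α) (((M - y) / M) ^ α) ∧
      (max (((y - L) / L) ^ α) (((M - y) / M) ^ α) = ((M - L) / (M + L)) ^ α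
        ↔ y = 2 * L * M / (L + M)) := by
  intro y _
  have hM : 0 < M := hL.trans hLM
  have hα0 : 0 < α := by linarith
  have hc : 0 ≤ (M - L) / (M + L) := div_nonneg (by linarith) (by linarith)
  have e1 : (M - L) / (M + L) = (2 * L * M / (L + M) - L) / L := by
    field_simp
    ring
  have e2 : (M - L) / (M + L) = (M - 2 * L * M / (L + M)) / M := by
    field_simp
    ring
  rcases lt_trichotomy y (2 * L * M / (L + M)) with h | h | h
  · have h1 : ((M - L) / (M + L)) ^ α < ((M - y) / M) ^ α := by
      apply Real.rpow_lt_rpow hc _ hα0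
      rw [e2]
      exact div_lt_div_of_pos_right (by linarith) hM
    have h2 := lt_max_of_lt_right (b := ((y - L) / L) ^ α) h1
    exact ⟨h2.le, fun h' => absurd h' h2.ne', fun h' => absurd h' h.ne⟩
  · have h1 : ((y - L) / L) = (M - L) / (M + L) := by rw [e1, h]
    have h2 : ((M - y) / M) = (M - L) / (M + L) := by rw [e2, h]
    rw [h1, h2, max_self]
    exact ⟨le_rfl, fun _ => h, fun _ => rfl⟩
  · have h1 : ((M - L) / (M + L)) ^ α < ((y - L) / L) ^ α := by
      apply Real.rpow_lt_rpow hc _ hα0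
      rw [e1]
      exact div_lt_div_of_pos_right (by linarith) hL
    have h2 := lt_max_of_lt_left (c := ((M - y) / M) ^ α) h1
    exact ⟨h2.le, fun h' => absurd h' h2.ne', fun h' => absurd h' h.ne'⟩
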